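/- arXiv:2501.16226 — 2 statements merged into one kernel-verified Lean document; each statement's English description precedes it below -/
import Mathlib

section
/- Fix N, M ≥ 1, vectors x_1,…,x_M ∈ ℝ^N and labels y_1,…,y_M ∈ ℝ. For λ > 0 let (ŵ(λ), B̂(λ)) ∈ ℝ^N × ℝ be a minimizer of the strictly convex objective L_λ(w, B) = Σ_{μ=1}^M ( y_μ − (w·x_μ/√N + B + 1)/2 )² + (λ/2)·‖w‖². Then as λ → ∞, λ·ŵ(λ) converges to (1/√N)·Σ_{μ=1}^M (y_μ − ȳ)·x_μ and B̂(λ) converges to 2ȳ − 1, where ȳ = (1/M)·Σ_{μ=1}^M y_μ. -/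
open Filter

/-- A quadratic `b t + a t²` that is nonnegative for all real `t` has `b = 0`. -/
theorem eq_zero_of_forall_quadratic_nonneg {a b : ℝ} (h : ∀ t : ℝ, 0 ≤ b * t + a * t ^ 2) :
    b = 0 := by
  have hd := discrim_le_zero (a := a) (b := b) (c := 0) fun t => by linarith [h t]
  rw [discrim] at hd
  nlinarith [sq_nonneg b]

/-- If `t ↦ ∑ (r - t d)² + c (s + p t + q t²)` is minimal at `t = 0`, its derivative there
vanishes. -/
theorem sum_mul_eq_of_forall_le {ι : Type*} [Fintype ι] (r d : ι → ℝ) (c s p q : ℝ)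
    (h : ∀ t : ℝ, ∑ m, r m ^ 2 + c * s
      ≤ ∑ m, (r m - t * d m) ^ 2 + c * (s + p * t + q * t ^ 2)) :
    2 * ∑ m, r m * d m = c * p := by
  have key : c * p - 2 * ∑ m, r m * d m = 0 := by
    refine eq_zero_of_forall_quadratic_nonneg (a := ∑ m, d m ^ 2 + c * q) fun t => ?_
    have e : ∑ m, (r m - t * d m) ^ 2
        = ∑ m, r m ^ 2 - 2 * t * ∑ m, r m * d m + t ^ 2 * ∑ m, d m ^ 2 := by
      rw [Finset.mul_sum, Finset.mul_sum, ← Finset.sum_sub_distrib, ← Finset.sum_add_distrib]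
      exact Finset.sum_congr rfl fun m _ => by ring
    have ht := h t
    rw [e] at ht
    linarith
  linarith

/-- A real function with `(l / 2) u(l)² ≤ C` for all `l > 0` tends to `0` at infinity. -/
theorem tendsto_zero_of_half_mul_sq_le {u : ℝ → ℝ} {C : ℝ}
    (h : ∀ l : ℝ, 0 < l → (l / 2) * u l ^ 2 ≤ C) : Tendsto u atTop (nhds 0) := by
  have hsq : Tendsto (fun l => u l ^ 2) atTop (nhds 0) := by
    refine squeeze_zero' (g := fun l => 2 * C / l) (Eventually.of_forall fun l => sq_nonneg _) ?_
      (tendsto_const_nhds.div_atTop tendsto_id)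
    filter_upwards [eventually_gt_atTop 0] with l hl
    rw [le_div_iff₀ hl]
    linarith [h l hl]
  have habs := hsq.sqrt
  simp only [Real.sqrt_sq_eq_abs, Real.sqrt_zero] at habs
  exact (tendsto_zero_iff_abs_tendsto_zero u).2 habs

/-- **Large-regularization limit of the ridge minimizer.**
If `(ŵ(λ), B̂(λ))` minimizes
`L_λ(w,B) = Σ_μ (y_μ − (w·x_μ/√N + B + 1)/2)² + (λ/2)‖w‖²`, then as `λ → ∞`,
`λ·ŵ(λ) → (1/√N)·Σ_μ (y_μ − ȳ)·x_μ` and `B̂(λ) → 2ȳ − 1`, where `ȳ` is the mean label. -/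
theorem stmt5 (N M : ℕ) (hN : 1 ≤ N) (hM : 1 ≤ M)
    (x : Fin M → Fin N → ℝ) (y : Fin M → ℝ)
    (what : ℝ → Fin N → ℝ) (Bhat : ℝ → ℝ)
    (hmin : ∀ l : ℝ, 0 < l → ∀ (w : Fin N → ℝ) (B : ℝ),
      (∑ μ, (y μ - ((∑ i, what l i * x μ i) / Real.sqrt N + Bhat l + 1) / 2) ^ 2
          + (l / 2) * ∑ i, (what l i) ^ 2)
        ≤ ∑ μ, (y μ - ((∑ i, w i * x μ i) / Real.sqrt N + B + 1) / 2) ^ 2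
          + (l / 2) * ∑ i, (w i) ^ 2) :
    Tendsto (fun l : ℝ => fun i => l * what l i) atTop
        (nhds fun i => (1 / Real.sqrt N) * ∑ μ, (y μ - (∑ ν, y ν) / M) * x μ i)
      ∧ Tendsto Bhat atTop (nhds (2 * ((∑ ν, y ν) / M) - 1)) := by
  have hM0 : (M : ℝ) ≠ 0 := Nat.cast_ne_zero.2 (by omega)
  set r : ℝ → Fin M → ℝ := fun l m =>
    y m - ((∑ i, what l i * x m i) / Real.sqrt N + Bhat l + 1) / 2 with hr
  have hB : ∀ l : ℝ, 0 < l → ∑ m, r l m = 0 := by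
    intro l hl
    have h := sum_mul_eq_of_forall_le (r l) (fun _ => 1 / 2) (l / 2) (∑ i, what l i ^ 2) 0 0
      fun t => by
        refine (hmin l hl (what l) (Bhat l + t)).trans_eq ?_
        congr 1
        · exact Finset.sum_congr rfl fun m _ => by simp only [hr]; ring
        · ring
    rw [← Finset.sum_mul] at h
    linarith
  have hw : ∀ l : ℝ, 0 < l → ∀ i, l * what l i = (1 / Real.sqrt N) * ∑ m, r l m * x m i := by
    intro l hl i
    have h := sum_mul_eq_of_forall_le (r l) (fun m => x m i / Real.sqrt N / 2) (l / 2)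
      (∑ j, what l j ^ 2) (2 * what l i) 1 fun t => by
        refine (hmin l hl (fun j => what l j + if j = i then t else 0) (Bhat l)).trans_eq ?_
        congr 1
        · refine Finset.sum_congr rfl fun m _ => ?_
          simp only [hr, add_mul, ite_mul, zero_mul, Finset.sum_add_distrib,
            Finset.sum_ite_eq', Finset.mem_univ, if_true]
          ring
        · congr 1
          have e : ∀ j, (what l j + if j = i then t else 0) ^ 2
              = what l j ^ 2 + if j = i then 2 * what l j * t + t ^ 2 else 0 := by
            intro j
            split_ifs <;> ring
          simp only [e, Finset.sum_add_distrib, Finset.sum_ite_eq', Finset.mem_univ, if_true]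
          ring
    have e : ∑ m, r l m * (x m i / Real.sqrt N / 2)
        = (1 / Real.sqrt N) * (∑ m, r l m * x m i) / 2 := by
      rw [Finset.mul_sum, Finset.sum_div]
      exact Finset.sum_congr rfl fun m _ => by ring
    rw [e] at h
    linarith
  have hw0 : ∀ i, Tendsto (fun l => what l i) atTop (nhds 0) := by
    intro i
    refine tendsto_zero_of_half_mul_sq_le (C := ∑ m, (y m - 1 / 2) ^ 2) fun l hl => ?_
    have h := hmin l hl 0 0
    simp only [Pi.zero_apply, zero_mul, Finset.sum_const_zero, zero_div, zero_add, ne_eq,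
      OfNat.ofNat_ne_zero, not_false_eq_true, zero_pow, mul_zero, add_zero] at h
    have hi : what l i ^ 2 ≤ ∑ j, what l j ^ 2 :=
      Finset.single_le_sum (f := fun j => what l j ^ 2) (fun j _ => sq_nonneg _)
        (Finset.mem_univ i)
    have hl2 := mul_le_mul_of_nonneg_left hi (half_pos hl).le
    have hs : 0 ≤ ∑ m, (y m - ((∑ i, what l i * x m i) / Real.sqrt N + Bhat l + 1) / 2) ^ 2 :=
      Finset.sum_nonneg fun m _ => sq_nonneg _
    linarith
  have hp : ∀ m, Tendsto (fun l => (∑ i, what l i * x m i) / Real.sqrt N) atTop (nhds 0) := by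
    intro m
    have h := (tendsto_finsetSum Finset.univ fun i _ => (hw0 i).mul_const (x m i)).div_const
      (Real.sqrt N)
    simpa using h
  have hBlim : Tendsto Bhat atTop (nhds (2 * ((∑ ν, y ν) / M) - 1)) := by
    have h := (tendsto_const_nhds (x := 2 * ((∑ ν, y ν) / M) - 1)).sub
      ((tendsto_finsetSum Finset.univ fun m _ => hp m).div_const (M : ℝ))
    simp only [Finset.sum_const_zero, zero_div, sub_zero] at h
    refine h.congr' ?_
    filter_upwards [eventually_gt_atTop 0] with l hl
    have e := hB l hl
    simp only [hr, Finset.sum_sub_distrib, ← Finset.sum_div, Finset.sum_add_distrib,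
      Finset.sum_const, Finset.card_univ, Fintype.card_fin, nsmul_eq_mul, mul_one] at e
    simp only [← Finset.sum_div]
    have e' : Bhat l * M = 2 * (∑ ν, y ν) - M - (∑ m, ∑ i, what l i * x m i) / Real.sqrt N := by
      linarith
    rw [eq_comm, eq_div_of_mul_eq hM0 e']
    field_simp
  refine ⟨tendsto_pi_nhds.2 fun i => ?_, hBlim⟩
  have hrlim : ∀ m, Tendsto (fun l => r l m) atTop (nhds (y m - (∑ ν, y ν) / M)) := by
    intro m
    have h := (tendsto_const_nhds (x := y m)).sub
      ((((hp m).add hBlim).add_const 1).div_const 2)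
    convert h using 2
    ring
  refine ((tendsto_finsetSum Finset.univ fun m _ =>
    (hrlim m).mul_const (x m i)).const_mul (1 / Real.sqrt N)).congr' ?_
  filter_upwards [eventually_gt_atTop 0] with l hl
  exact (hw l hl i).symm
end

section
/- (Appendix D Proposition, t = 0 part.) Let Δ > 0, α > 0, θ ∈ [0,1/2). For each N ≥ 1 set M = ⌈αN⌉ and generate training data as follows: y_μ^true ∈ {0,1} are i.i.d. with P(y_μ^true = 1) = 1/2; y_μ ≠ y_μ^true with probability θ independently; x_μ = (2y_μ^true − 1)·v/√N + √Δ·z_μ with v = (1,…,1)^⊤ ∈ ℝ^N and z_μ i.i.d. standard Gaussian vectors in ℝ^N. Let ŵ⁰ = (1/M)·Σ_{μ=1}^M (2y_μ − 1)·x_μ and let E⁰_N be the conditional misclassification probability P( sign(ŵ⁰·x) ≠ 2y^true − 1 | training data ) for an independent test pair (x, y^true) generated in the same way. Then as N → ∞, E⁰_N converges in probability to H( √α·(1 − 2θ) / √( Δ·(Δ + α·(1 − 2θ)²) ) ). -/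
open MeasureTheory ProbabilityTheory Filter

/-- The standard Gaussian tail function `H(x) = ∫_x^∞ e^{−t²/2}/√(2π) dt`. -/
noncomputable def Hfun (x : ℝ) : ℝ :=
  ∫ t in Set.Ioi x, Real.exp (-t ^ 2 / 2) / Real.sqrt (2 * Real.pi)

/-- Bernoulli measure on `ℝ`: mass `p` at `1` and `1 − p` at `0`. -/
noncomputable def bern (p : ℝ) : Measure ℝ :=
  ENNReal.ofReal p • Measure.dirac 1 + ENNReal.ofReal (1 - p) • Measure.dirac 0

/-- The law of a standard Gaussian vector in `ℝ^N` (i.i.d. `N(0,1)` coordinates). -/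
noncomputable def stdGaussianVec (N : ℕ) : Measure (Fin N → ℝ) :=
  Measure.pi fun _ => gaussianReal 0 1

/-- Sample space of the training data: true labels, flip indicators and noise vectors. -/
abbrev TrainSpace (N M : ℕ) := (Fin M → ℝ) × (Fin M → ℝ) × (Fin M → Fin N → ℝ)

/-- Law of the training data for balanced classes (`ρ = 1/2`) with label-noise rate `θ`:
i.i.d. Bernoulli(1/2) true labels, i.i.d. Bernoulli(θ) flip indicators,
i.i.d. standard Gaussian noise vectors, all jointly independent. -/
noncomputable def trainMeasure (N M : ℕ) (θ : ℝ) : Measure (TrainSpace N M) :=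
  (Measure.pi fun _ : Fin M => bern (1 / 2)).prod
    ((Measure.pi fun _ : Fin M => bern θ).prod (Measure.pi fun _ : Fin M => stdGaussianVec N))

/-- The observed (noisy) label `y_μ`: the true label `ω.1 μ`, flipped when the flip
indicator `ω.2.1 μ` equals `1`. -/
noncomputable def obsLabel {N M : ℕ} (ω : TrainSpace N M) (μ : Fin M) : ℝ :=
  if ω.2.1 μ = 1 then 1 - ω.1 μ else ω.1 μ

/-- The feature vector `x_μ = (2y_μ^true − 1)·v/√N + √Δ·z_μ` with `v = (1,…,1)ᵀ`. -/
noncomputable def dataVec {N M : ℕ} (Δ : ℝ) (ω : TrainSpace N M) (μ : Fin M) : Fin N → ℝ :=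
  fun i => (2 * ω.1 μ - 1) * 1 / Real.sqrt N + Real.sqrt Δ * ω.2.2 μ i

/-- The averaging estimator `ŵ⁰ = (1/M)·Σ_μ (2y_μ − 1)·x_μ`. -/
noncomputable def w0 {N M : ℕ} (Δ : ℝ) (ω : TrainSpace N M) : Fin N → ℝ :=
  fun i => (1 / (M : ℝ)) * ∑ μ, (2 * obsLabel ω μ - 1) * dataVec Δ ω μ i

/-- Law of an independent test pair `(x, y^true)`: `y^true ~ Bernoulli(1/2)` and
`x = (2y^true − 1)·v/√N + √Δ·z` with `z` a standard Gaussian vector. -/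
noncomputable def testMeasure (N : ℕ) (Δ : ℝ) : Measure ((Fin N → ℝ) × ℝ) :=
  Measure.map
    (fun p : ℝ × (Fin N → ℝ) =>
      (fun i => (2 * p.1 - 1) * 1 / Real.sqrt N + Real.sqrt Δ * p.2 i, p.1))
    ((bern (1 / 2)).prod (stdGaussianVec N))

/-- The conditional misclassification probability given the training data, i.e. the
probability over an independent test pair `(x, y^true)` that `sign(w·x) ≠ 2y^true − 1`. -/
noncomputable def genErr (N : ℕ) (Δ : ℝ) (w : Fin N → ℝ) : ℝ :=
  (testMeasure N Δ {p | Real.sign (∑ i, w i * p.1 i) ≠ 2 * p.2 - 1}).toReal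

lemma isProbabilityMeasure_bern {p : ℝ} (h0 : 0 ≤ p) (h1 : p ≤ 1) :
    IsProbabilityMeasure (bern p) := by
  refine ⟨?_⟩
  simp only [bern, Measure.add_apply, Measure.smul_apply, measure_univ, smul_eq_mul, mul_one]
  rw [← ENNReal.ofReal_add h0 (by linarith)]
  simp

lemma ae_bern (p : ℝ) : ∀ᵐ x ∂bern p, x = 1 ∨ x = 0 := by
  rw [bern, ae_add_measure_iff]
  constructor <;> refine Measure.ae_smul_measure ?_ _ <;>
    rw [ae_dirac_iff (by measurability)] <;> simp

lemma integral_bern {p : ℝ} (h0 : 0 ≤ p) (h1 : p ≤ 1) (f : ℝ → ℝ) :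
    ∫ x, f x ∂bern p = p * f 1 + (1 - p) * f 0 := by
  rw [bern, integral_add_measure, integral_smul_measure, integral_smul_measure, integral_dirac,
    integral_dirac, ENNReal.toReal_ofReal h0, ENNReal.toReal_ofReal (by linarith)]
  · simp
  · exact (integrable_dirac (by simp)).smul_measure (by simp)
  · exact (integrable_dirac (by simp)).smul_measure (by simp)

instance isProbabilityMeasure_stdGaussianVec (N : ℕ) :
    IsProbabilityMeasure (stdGaussianVec N) := by
  unfold stdGaussianVec; infer_instance

lemma Hfun_eq_measureReal_Ici (x : ℝ) : Hfun x = (gaussianReal 0 1).real (Set.Ici x) := by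
  rw [Measure.real, gaussianReal_apply_eq_integral _ one_ne_zero, integral_Ici_eq_integral_Ioi,
    ENNReal.toReal_ofReal (integral_nonneg fun _ => gaussianPDFReal_nonneg _ _ _)]
  simp [Hfun, gaussianPDFReal_def, div_eq_inv_mul]

lemma gaussianReal_Iic_neg (x : ℝ) :
    gaussianReal 0 1 (Set.Iic (-x)) = gaussianReal 0 1 (Set.Ici x) := by
  have h : (gaussianReal 0 1).map (fun x => -x) = gaussianReal 0 1 := by
    rw [gaussianReal_map_neg, neg_zero]
  conv_lhs => rw [← h, Measure.map_apply measurable_neg measurableSet_Iic]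
  congr 1
  ext; simp

lemma continuous_Hfun : Continuous Hfun := by
  have hint : Integrable (fun t : ℝ => Real.exp (-t ^ 2 / 2) / Real.sqrt (2 * Real.pi)) := by
    have := integrable_gaussianPDFReal 0 1
    simpa [gaussianPDFReal_def, div_eq_inv_mul] using this
  have h : Hfun = fun x => Hfun 0 - ∫ t in (0 : ℝ)..x,
      Real.exp (-t ^ 2 / 2) / Real.sqrt (2 * Real.pi) := by
    ext x
    rw [← intervalIntegral.integral_Ioi_sub_Ioi' hint.integrableOn hint.integrableOn]
    simp [Hfun]
  rw [h]
  exact continuous_const.sub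
    (intervalIntegral.continuous_primitive (fun _ _ => hint.intervalIntegrable) 0)

lemma measurePreserving_sum_mul {ι : Type*} [Fintype ι] (a : ι → ℝ) (ha : ∑ i, a i ^ 2 = 1) :
    MeasurePreserving (fun z : ι → ℝ => ∑ i, a i * z i)
      (Measure.pi fun _ => gaussianReal 0 1) (gaussianReal 0 1) := by
  have hm : Measurable (fun z : ι → ℝ => ∑ i, a i * z i) := by fun_prop
  refine ⟨hm, ?_⟩
  have : IsProbabilityMeasure
      ((Measure.pi fun _ : ι => gaussianReal 0 1).map (fun z => ∑ i, a i * z i)) :=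
    Measure.isProbabilityMeasure_map hm.aemeasurable
  refine Measure.ext_of_charFun ?_
  ext t
  rw [charFun_apply_real, integral_map hm.aemeasurable (by fun_prop)]
  have h1 : ∀ z : ι → ℝ, Complex.exp (t * ((∑ i, a i * z i : ℝ) : ℂ) * Complex.I)
      = ∏ i, Complex.exp (((t * a i : ℝ) : ℂ) * z i * Complex.I) := by
    intro z
    rw [← Complex.exp_sum]
    push_cast
    rw [Finset.mul_sum, Finset.sum_mul]
    simp_rw [mul_assoc]
  simp_rw [h1]
  rw [integral_fintype_prod_eq_prod
    (f := fun i (x : ℝ) => Complex.exp (((t * a i : ℝ) : ℂ) * x * Complex.I))]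
  simp_rw [← charFun_apply_real, charFun_gaussianReal, ← Complex.exp_sum]
  congr 1
  have h2 : (∑ i, (a i : ℂ) ^ 2) = 1 := by exact_mod_cast ha
  simp only [Complex.ofReal_zero, mul_zero, zero_mul, NNReal.coe_one, Complex.ofReal_one, one_mul,
    zero_sub, Complex.ofReal_mul, mul_pow]
  rw [Finset.sum_neg_distrib, ← Finset.sum_div, ← Finset.mul_sum, h2, mul_one]

lemma measurePreserving_curry {ι κ X : Type*} [Fintype ι] [Fintype κ] [MeasurableSpace X]
    (ν : Measure X) [IsProbabilityMeasure ν] :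
    MeasurePreserving (MeasurableEquiv.curry ι κ X)
      (Measure.pi fun _ => ν) (Measure.pi fun _ => Measure.pi fun _ => ν) := by
  refine ⟨MeasurableEquiv.measurable _, ?_⟩
  simpa only [Measure.infinitePi_eq_pi] using
    Measure.infinitePi_map_curry (fun (_ : ι) (_ : κ) => ν)

lemma measurePreserving_swap_pi {ι κ X : Type*} [Fintype ι] [Fintype κ] [MeasurableSpace X]
    (ν : Measure X) [IsProbabilityMeasure ν] :
    MeasurePreserving (fun (z : ι → κ → X) j i => z i j)
      (Measure.pi fun _ => Measure.pi fun _ => ν) (Measure.pi fun _ => Measure.pi fun _ => ν) := by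
  have h := (measurePreserving_curry (ι := κ) (κ := ι) ν).comp
    ((measurePreserving_piCongrLeft (fun _ : κ × ι => ν) (Equiv.prodComm ι κ)).comp
      (measurePreserving_curry (ι := ι) (κ := κ) ν).symm)
  convert h using 1
  ext z j i
  rfl

lemma measurePreserving_sum_rows {M N : ℕ} (a : Fin M → ℝ) (ha : ∑ μ, a μ ^ 2 = 1) :
    MeasurePreserving (fun (z : Fin M → Fin N → ℝ) i => ∑ μ, a μ * z μ i)
      (Measure.pi fun _ => stdGaussianVec N) (stdGaussianVec N) := by
  have h := (measurePreserving_pi (fun _ : Fin N => Measure.pi fun _ : Fin M => gaussianReal 0 1)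
    (fun _ => gaussianReal 0 1) (fun _ => measurePreserving_sum_mul a ha)).comp
      (measurePreserving_swap_pi (ι := Fin M) (κ := Fin N) (gaussianReal 0 1))
  exact h

lemma measurePreserving_uncurry_of_ae {A B C : Type*} [MeasurableSpace A] [MeasurableSpace B]
    [MeasurableSpace C] {μa : Measure A} {μb : Measure B} {μc : Measure C}
    [IsProbabilityMeasure μa] [SFinite μb] [SFinite μc] {g : A → B → C}
    (hgm : Measurable (Function.uncurry g)) (hg : ∀ᵐ a ∂μa, μb.map (g a) = μc) :
    MeasurePreserving (Function.uncurry g) (μa.prod μb) μc :=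
  measurePreserving_snd.comp ((MeasurePreserving.id μa).skew_product hgm hg)

lemma pi_measure_abs_average_sub_le {ν : Measure ℝ} [IsProbabilityMeasure ν] {f : ℝ → ℝ}
    (hf : MemLp f 2 ν) {n : ℕ} (hn : 0 < n) {δ : ℝ} (hδ : 0 < δ) :
    (Measure.pi fun _ : Fin n => ν) {x | δ ≤ |(∑ i, f (x i)) / n - ∫ t, f t ∂ν|}
      ≤ ENNReal.ofReal (Var[f; ν] / δ ^ 2 / n) := by
  have hn' : (0 : ℝ) < n := by exact_mod_cast hn
  have hL : ∀ i : Fin n, MemLp (fun x : Fin n → ℝ => f (x i)) 2 (Measure.pi fun _ => ν) :=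
    fun i => hf.comp_measurePreserving (measurePreserving_eval (fun _ : Fin n => ν) i)
  have hsum : MemLp (∑ i, fun x : Fin n → ℝ => f (x i)) 2 (Measure.pi fun _ => ν) :=
    memLp_finsetSum' _ fun i _ => hL i
  have hmean : ∫ x, (∑ i, fun x : Fin n → ℝ => f (x i)) x ∂(Measure.pi fun _ => ν)
      = n * ∫ t, f t ∂ν := by
    simp only [Finset.sum_apply]
    rw [integral_finsetSum _ fun i _ => (hL i).integrable one_le_two]
    simp [integral_comp_eval (μ := fun _ : Fin n => ν) hf.aestronglyMeasurable]
  have h := meas_ge_le_variance_div_sq hsum (c := n * δ) (by positivity)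
  rw [variance_sum_pi (μ := fun _ => ν) (X := fun _ => f) (fun _ => hf), hmean] at h
  refine (measure_mono ?_).trans (h.trans_eq ?_)
  · intro x hx
    simp only [Set.mem_ofPred_eq, Finset.sum_apply] at hx ⊢
    have : (∑ i, f (x i)) - n * ∫ t, f t ∂ν = n * ((∑ i, f (x i)) / n - ∫ t, f t ∂ν) := by
      field_simp
    rw [this, abs_mul, abs_of_pos hn']
    gcongr
  · congr 1
    simp
    field_simp

lemma tendsto_ofReal_div_natCast_comp {u : ℕ → ℕ} (hu : Tendsto u atTop atTop) (c : ℝ) :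
    Tendsto (fun N => ENNReal.ofReal (c / (u N : ℝ))) atTop (nhds 0) := by
  have := ((tendsto_const_nhds (x := c)).div_atTop
    (tendsto_natCast_atTop_atTop.comp hu) : Tendsto (fun N => c / (u N : ℝ)) atTop (nhds 0))
  simpa using ENNReal.tendsto_ofReal this

lemma measurable_real_sign : Measurable Real.sign := by
  unfold Real.sign
  exact Measurable.ite measurableSet_Iio measurable_const
    (Measurable.ite measurableSet_Ioi measurable_const measurable_const)

lemma real_sign_ne_one_iff (r : ℝ) : Real.sign r ≠ 1 ↔ r ≤ 0 := by
  rcases lt_trichotomy r 0 with h | h | h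
  · simp [Real.sign_of_neg h, h.le]; norm_num
  · simp [h]
  · simp [Real.sign_of_pos h, h]

lemma real_sign_ne_neg_one_iff (r : ℝ) : Real.sign r ≠ -1 ↔ 0 ≤ r := by
  rw [← real_sign_ne_one_iff (-r) |>.trans neg_nonpos, Real.sign_neg, ne_eq, ne_eq,
    neg_eq_iff_eq_neg]

lemma genErr_eq {N : ℕ} {Δ : ℝ} (hΔ : 0 < Δ) (w : Fin N → ℝ) (hq : 0 < ∑ i, w i ^ 2) :
    genErr N Δ w = Hfun ((∑ i, w i) / Real.sqrt N / Real.sqrt (Δ * ∑ i, w i ^ 2)) := by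
  set q := ∑ i, w i ^ 2 with hqdef
  set m := (∑ i, w i) / Real.sqrt N with hm
  have := isProbabilityMeasure_bern (p := 1 / 2) (by norm_num) (by norm_num)
  have hs : 0 < Real.sqrt (Δ * q) := Real.sqrt_pos.2 (mul_pos hΔ hq)
  have hL := measurePreserving_sum_mul (fun i => w i / Real.sqrt q) (by
    simp_rw [div_pow, Real.sq_sqrt hq.le, ← Finset.sum_div]
    exact div_self hq.ne')
  set L : (Fin N → ℝ) → ℝ := fun z => ∑ i, w i / Real.sqrt q * z i with hLdef
  have hdot : ∀ (c : ℝ) (z : Fin N → ℝ),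
      ∑ i, w i * (c * 1 / Real.sqrt N + Real.sqrt Δ * z i) = c * m + Real.sqrt (Δ * q) * L z := by
    intro c z
    have hq' : Real.sqrt q ≠ 0 := (Real.sqrt_pos.2 hq).ne'
    rw [hm, hLdef, Real.sqrt_mul hΔ.le, Finset.sum_div, Finset.mul_sum, Finset.mul_sum,
      ← Finset.sum_add_distrib]
    refine Finset.sum_congr rfl fun i _ => ?_
    field_simp
  have hmeas : Measurable (fun p : ℝ × (Fin N → ℝ) =>
      ((fun i => (2 * p.1 - 1) * 1 / Real.sqrt N + Real.sqrt Δ * p.2 i, p.1) :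
        (Fin N → ℝ) × ℝ)) := by fun_prop
  have hS : MeasurableSet
      {p : (Fin N → ℝ) × ℝ | Real.sign (∑ i, w i * p.1 i) ≠ 2 * p.2 - 1} :=
    (measurableSet_eq_fun (measurable_real_sign.comp (by fun_prop)) (by fun_prop)).compl
  rw [genErr, testMeasure, Measure.map_apply hmeas hS, Measure.prod_apply (hmeas hS), bern,
    lintegral_add_measure, lintegral_smul_measure, lintegral_smul_measure, lintegral_dirac,
    lintegral_dirac, Hfun_eq_measureReal_Ici]
  have h1 : stdGaussianVec N (Prod.mk 1 ⁻¹' ((fun p : ℝ × (Fin N → ℝ) =>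
      ((fun i => (2 * p.1 - 1) * 1 / Real.sqrt N + Real.sqrt Δ * p.2 i, p.1) :
        (Fin N → ℝ) × ℝ)) ⁻¹'
        {p | Real.sign (∑ i, w i * p.1 i) ≠ 2 * p.2 - 1}))
      = gaussianReal 0 1 (Set.Ici (m / Real.sqrt (Δ * q))) := by
    rw [← gaussianReal_Iic_neg, ← hL.measure_preimage measurableSet_Iic.nullMeasurableSet]
    refine congrArg _ ?_
    ext z
    simp only [Set.mem_preimage, Set.mem_ofPred_eq, Set.mem_Iic, hdot]
    norm_num only [real_sign_ne_one_iff]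
    rw [← neg_div, le_div_iff₀ hs]
    constructor <;> intro h <;> linarith
  have h0 : stdGaussianVec N (Prod.mk 0 ⁻¹' ((fun p : ℝ × (Fin N → ℝ) =>
      ((fun i => (2 * p.1 - 1) * 1 / Real.sqrt N + Real.sqrt Δ * p.2 i, p.1) :
        (Fin N → ℝ) × ℝ)) ⁻¹'
        {p | Real.sign (∑ i, w i * p.1 i) ≠ 2 * p.2 - 1}))
      = gaussianReal 0 1 (Set.Ici (m / Real.sqrt (Δ * q))) := by
    rw [← hL.measure_preimage measurableSet_Ici.nullMeasurableSet]
    refine congrArg _ ?_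
    ext z
    simp only [Set.mem_preimage, Set.mem_ofPred_eq, Set.mem_Ici, hdot]
    norm_num only [real_sign_ne_neg_one_iff]
    rw [div_le_iff₀ hs]
    constructor <;> intro h <;> linarith
  rw [h1, h0, ← add_smul, ← ENNReal.ofReal_add (by norm_num) (by norm_num)]
  norm_num [Measure.real]

/-- The sign by which the flip indicator multiplies the true label in `{-1, 1}`. -/
noncomputable def flipSign (t : ℝ) : ℝ := if t = 1 then -1 else 1

lemma measurable_flipSign : Measurable flipSign :=
  Measurable.ite (measurableSet_singleton 1) measurable_const measurable_const

lemma memLp_flipSign {θ : ℝ} [IsFiniteMeasure (bern θ)] : MemLp flipSign 2 (bern θ) :=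
  MemLp.of_bound measurable_flipSign.aestronglyMeasurable 1
    (ae_of_all _ fun t => by unfold flipSign; split_ifs <;> simp)

/-- The normalized label-weighted sum of the noise vectors. -/
noncomputable def noiseSum {N M : ℕ} (ω : TrainSpace N M) : Fin N → ℝ :=
  fun i => ∑ μ, (2 * obsLabel ω μ - 1) / Real.sqrt M * ω.2.2 μ i

lemma measurable_obsLabel {N M : ℕ} (μ : Fin M) :
    Measurable (fun ω : TrainSpace N M => obsLabel ω μ) := by
  unfold obsLabel
  refine Measurable.ite (measurableSet_eq_fun (by fun_prop) (by fun_prop)) ?_ ?_ <;> fun_prop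

lemma measurable_noiseSum {N M : ℕ} : Measurable (noiseSum : TrainSpace N M → Fin N → ℝ) := by
  refine measurable_pi_lambda _ fun i => ?_
  unfold noiseSum
  have := fun μ => measurable_obsLabel (N := N) (M := M) μ
  fun_prop

lemma ae_pi_bern (p : ℝ) [IsProbabilityMeasure (bern p)] (M : ℕ) :
    ∀ᵐ y ∂(Measure.pi fun _ : Fin M => bern p), ∀ μ, y μ = 1 ∨ y μ = 0 := by
  rw [eventually_all]
  intro μ
  exact (measurePreserving_eval (fun _ : Fin M => bern p) μ).quasiMeasurePreserving.ae (ae_bern p)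

lemma sq_two_mul_obsLabel_sub_one {N M : ℕ} {ω : TrainSpace N M} {μ : Fin M}
    (h : ω.1 μ = 1 ∨ ω.1 μ = 0) : (2 * obsLabel ω μ - 1) ^ 2 = 1 := by
  unfold obsLabel
  rcases h with h | h <;> split_ifs <;> rw [h] <;> norm_num

lemma measurePreserving_noiseSum {N M : ℕ} (hM : 0 < M) {θ : ℝ}
    [IsProbabilityMeasure (bern θ)] :
    MeasurePreserving (noiseSum : TrainSpace N M → Fin N → ℝ) (trainMeasure N M θ)
      (stdGaussianVec N) := by
  have := isProbabilityMeasure_bern (p := 1 / 2) (by norm_num) (by norm_num)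
  refine measurePreserving_uncurry_of_ae
    (g := fun y r => noiseSum ((y, r) : TrainSpace N M)) measurable_noiseSum ?_
  filter_upwards [ae_pi_bern (1 / 2) M] with y hy
  refine (measurePreserving_uncurry_of_ae
    (g := fun f z => noiseSum ((y, f, z) : TrainSpace N M)) ?_ ?_).map_eq
  · exact measurable_noiseSum.comp (measurable_const.prodMk measurable_id)
  · refine ae_of_all _ fun f => ?_
    refine (measurePreserving_sum_rows
      (fun μ => (2 * obsLabel ((y, f, 0) : TrainSpace N M) μ - 1) / Real.sqrt M) ?_).map_eq
    have hM' : (M : ℝ) ≠ 0 := by positivity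
    simp_rw [div_pow, sq_two_mul_obsLabel_sub_one (N := N) (ω := (y, f, 0)) (hy _)]
    simp [hM']

lemma w0_eq {N M : ℕ} (hM : 0 < M) (Δ : ℝ) {ω : TrainSpace N M}
    (hω : ∀ μ, ω.1 μ = 1 ∨ ω.1 μ = 0) (i : Fin N) :
    w0 Δ ω i = (∑ μ, flipSign (ω.2.1 μ)) / M / Real.sqrt N
      + Real.sqrt Δ / Real.sqrt M * noiseSum ω i := by
  have hM' : (0 : ℝ) < M := by exact_mod_cast hM
  have hsM := Real.sqrt_pos.2 hM'
  have hsM2 := Real.sq_sqrt hM'.le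
  unfold w0 noiseSum dataVec
  rw [Finset.sum_div, Finset.sum_div, Finset.mul_sum, Finset.mul_sum, ← Finset.sum_add_distrib]
  refine Finset.sum_congr rfl fun μ _ => ?_
  have hflip : (2 * obsLabel ω μ - 1) * (2 * ω.1 μ - 1) = flipSign (ω.2.1 μ) := by
    unfold obsLabel flipSign
    rcases hω μ with h | h <;> split_ifs <;> rw [h] <;> norm_num
  rw [← hflip]
  have : Real.sqrt Δ / Real.sqrt M * ((2 * obsLabel ω μ - 1) / Real.sqrt M * ω.2.2 μ i)
      = Real.sqrt Δ * (2 * obsLabel ω μ - 1) * ω.2.2 μ i / M := by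
    generalize Real.sqrt M = sM at *
    rw [← hsM2]
    field_simp
  rw [this]
  field_simp

/-- The mean margin of the classifier as a function of the label average `p.1`, the noise
averages `p.2.1`, `p.2.2.1` and the aspect ratio `p.2.2.2`. -/
noncomputable def marginMean (Δ : ℝ) (p : ℝ × ℝ × ℝ × ℝ) : ℝ :=
  p.1 + Real.sqrt (Δ * p.2.2.2) * p.2.1

/-- The squared norm of the estimator in terms of the same statistics as `marginMean`. -/
noncomputable def normSq (Δ : ℝ) (p : ℝ × ℝ × ℝ × ℝ) : ℝ :=
  p.1 ^ 2 + 2 * p.1 * Real.sqrt (Δ * p.2.2.2) * p.2.1 + Δ * p.2.2.2 * p.2.2.1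

/-- The empirical statistics on which the generalization error depends. -/
noncomputable def trainStats {N M : ℕ} (ω : TrainSpace N M) : ℝ × ℝ × ℝ × ℝ :=
  ((∑ μ, flipSign (ω.2.1 μ)) / M, (∑ i, noiseSum ω i) / N, (∑ i, noiseSum ω i ^ 2) / N, N / M)

lemma sum_w0_div_sqrt {N M : ℕ} (hN : 0 < N) (hM : 0 < M) {Δ : ℝ} (hΔ : 0 < Δ)
    {ω : TrainSpace N M} (hω : ∀ μ, ω.1 μ = 1 ∨ ω.1 μ = 0) :
    (∑ i, w0 Δ ω i) / Real.sqrt N = marginMean Δ (trainStats ω) := by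
  have hN' : (0 : ℝ) < N := by exact_mod_cast hN
  have hsN := Real.sqrt_pos.2 hN'
  have hsN2 := Real.sq_sqrt hN'.le
  have hsM : 0 < Real.sqrt M := Real.sqrt_pos.2 (by exact_mod_cast hM)
  simp_rw [w0_eq hM Δ hω, Finset.sum_add_distrib, ← Finset.mul_sum]
  simp only [marginMean, trainStats, Finset.sum_const, Finset.card_univ, Fintype.card_fin,
    nsmul_eq_mul]
  rw [Real.sqrt_mul hΔ.le, Real.sqrt_div hN'.le]
  generalize (∑ μ, flipSign (ω.2.1 μ)) / (M : ℝ) = A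
  generalize ∑ i, noiseSum ω i = S
  generalize Real.sqrt M = sM at *
  generalize Real.sqrt Δ = sD
  generalize Real.sqrt N = sN at *
  rw [← hsN2]
  field_simp

lemma sum_w0_sq {N M : ℕ} (hN : 0 < N) (hM : 0 < M) {Δ : ℝ} (hΔ : 0 < Δ)
    {ω : TrainSpace N M} (hω : ∀ μ, ω.1 μ = 1 ∨ ω.1 μ = 0) :
    ∑ i, w0 Δ ω i ^ 2 = normSq Δ (trainStats ω) := by
  have hN' : (0 : ℝ) < N := by exact_mod_cast hN
  have hM' : (0 : ℝ) < M := by exact_mod_cast hM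
  have hsN := Real.sqrt_pos.2 hN'
  have hsN2 := Real.sq_sqrt hN'.le
  have hsM := Real.sqrt_pos.2 hM'
  have hsM2 := Real.sq_sqrt hM'.le
  have hD2 := Real.sq_sqrt hΔ.le
  simp only [normSq, trainStats]
  simp_rw [w0_eq hM Δ hω, add_sq, mul_pow, Finset.sum_add_distrib, ← Finset.mul_sum]
  simp only [Finset.sum_const, Finset.card_univ, Fintype.card_fin, nsmul_eq_mul]
  rw [Real.sqrt_mul hΔ.le, Real.sqrt_div hN'.le]
  generalize (∑ μ, flipSign (ω.2.1 μ)) / (M : ℝ) = A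
  generalize ∑ i, noiseSum ω i = S
  generalize ∑ i, noiseSum ω i ^ 2 = Q
  generalize Real.sqrt M = sM at *
  generalize Real.sqrt Δ = sD at *
  generalize Real.sqrt N = sN at *
  rw [← hsN2, ← hsM2, ← hD2]
  field_simp

lemma genErr_w0 {N M : ℕ} (hN : 0 < N) (hM : 0 < M) {Δ : ℝ} (hΔ : 0 < Δ)
    {ω : TrainSpace N M} (hω : ∀ μ, ω.1 μ = 1 ∨ ω.1 μ = 0) (hq : 0 < normSq Δ (trainStats ω)) :
    genErr N Δ (w0 Δ ω)
      = Hfun (marginMean Δ (trainStats ω) / Real.sqrt (Δ * normSq Δ (trainStats ω))) := by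
  rw [← sum_w0_sq hN hM hΔ hω] at hq ⊢
  rw [genErr_eq hΔ _ hq, sum_w0_div_sqrt hN hM hΔ hω]

lemma eventually_normSq_pos_and_abs_sub_lt {Δ α θ ε : ℝ} (hΔ : 0 < Δ) (hα : 0 < α)
    (hε : 0 < ε) :
    ∀ᶠ p in nhds ((1 - 2 * θ, 0, 1, 1 / α) : ℝ × ℝ × ℝ × ℝ), 0 < normSq Δ p ∧
      |Hfun (marginMean Δ p / Real.sqrt (Δ * normSq Δ p))
        - Hfun (Real.sqrt α * (1 - 2 * θ)
          / Real.sqrt (Δ * (Δ + α * (1 - 2 * θ) ^ 2)))| < ε := by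
  set p₀ : ℝ × ℝ × ℝ × ℝ := (1 - 2 * θ, 0, 1, 1 / α) with hp₀
  have hcm : Continuous (marginMean Δ) := by unfold marginMean; fun_prop
  have hcq : Continuous (normSq Δ) := by unfold normSq; fun_prop
  have hq₀ : normSq Δ p₀ = (1 - 2 * θ) ^ 2 + Δ / α := by
    simp only [normSq, hp₀]; ring
  have hpos : 0 < normSq Δ p₀ := by rw [hq₀]; positivity
  have hlim : Real.sqrt α * (1 - 2 * θ) / Real.sqrt (Δ * (Δ + α * (1 - 2 * θ) ^ 2))
      = marginMean Δ p₀ / Real.sqrt (Δ * normSq Δ p₀) := by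
    have : Δ * (Δ + α * (1 - 2 * θ) ^ 2) = α * (Δ * normSq Δ p₀) := by
      rw [hq₀]; field_simp; ring
    rw [this, Real.sqrt_mul hα.le, mul_div_mul_left _ _ (Real.sqrt_pos.2 hα).ne']
    simp [marginMean, hp₀]
  refine (hcq.continuousAt.eventually (lt_mem_nhds hpos)).and ?_
  have hcont : ContinuousAt
      (fun p => Hfun (marginMean Δ p / Real.sqrt (Δ * normSq Δ p))) p₀ :=
    continuous_Hfun.continuousAt.comp (hcm.continuousAt.div
      (continuous_const.mul hcq).sqrt.continuousAt (Real.sqrt_pos.2 (mul_pos hΔ hpos)).ne')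
  rw [hlim]
  exact Metric.tendsto_nhds.1 hcont ε hε

lemma tendsto_natCast_div_ceil {α : ℝ} (hα : 0 < α) :
    Tendsto (fun N : ℕ => (N : ℝ) / (Nat.ceil (α * N) : ℕ)) atTop (nhds (1 / α)) := by
  have h : Tendsto (fun N : ℕ => (Nat.ceil (α * N) : ℝ) / N) atTop (nhds α) :=
    (tendsto_nat_ceil_mul_div_atTop hα.le).comp tendsto_natCast_atTop_atTop
  simpa using h.inv₀ hα.ne'

lemma tendsto_ceil_mul_natCast {α : ℝ} (hα : 0 < α) :
    Tendsto (fun N : ℕ => Nat.ceil (α * N)) atTop atTop :=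
  tendsto_nat_ceil_atTop.comp (tendsto_natCast_atTop_atTop.const_mul_atTop hα)

lemma integral_sq_gaussianReal : ∫ x, x ^ 2 ∂gaussianReal 0 1 = 1 := by
  have h := variance_fun_id_gaussianReal (μ := 0) (v := 1)
  rw [variance_eq_integral (by fun_prop)] at h
  simpa [integral_id_gaussianReal] using h

lemma memLp_sq_gaussianReal : MemLp (fun x : ℝ => x ^ 2) 2 (gaussianReal 0 1) := by
  have h : MemLp (fun x : ℝ => x) 4 (gaussianReal 0 1) :=
    memLp_id_gaussianReal' 4 (by norm_num)
  rw [memLp_two_iff_integrable_sq (by fun_prop)]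
  refine (h.integrable_norm_pow (by norm_num)).congr (ae_of_all _ fun x => ?_)
  simp only [Real.norm_eq_abs]
  rw [← pow_mul]
  norm_num [Even.pow_abs]

/-- **Appendix D Proposition, `t = 0` part.**
With `M = ⌈αN⌉`, the conditional generalization error of the averaging estimator `ŵ⁰`
converges in probability, as `N → ∞`, to
`H(√α(1 − 2θ)/√(Δ(Δ + α(1 − 2θ)²)))`. -/
theorem stmt7 (Δ α θ : ℝ) (hΔ : 0 < Δ) (hα : 0 < α) (hθ0 : 0 ≤ θ) (hθ : θ < 1 / 2) :
    ∀ ε > (0 : ℝ),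
      Tendsto
        (fun N : ℕ =>
          trainMeasure N (Nat.ceil (α * N)) θ
            {ω | ε ≤ |genErr N Δ (w0 Δ ω)
              - Hfun (Real.sqrt α * (1 - 2 * θ)
                  / Real.sqrt (Δ * (Δ + α * (1 - 2 * θ) ^ 2)))|})
        atTop (nhds 0) := by
  intro ε hε
  have := isProbabilityMeasure_bern (p := 1 / 2) (by norm_num) (by norm_num)
  have := isProbabilityMeasure_bern (p := θ) hθ0 (by linarith)
  obtain ⟨δ, hδ, hδε⟩ :=
    Metric.eventually_nhds_iff.1 (eventually_normSq_pos_and_abs_sub_lt (θ := θ) hΔ hα hε)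
  have hgid : MemLp (fun x : ℝ => x) 2 (gaussianReal 0 1) := memLp_id_gaussianReal' 2 (by norm_num)
  have hM := tendsto_ceil_mul_natCast hα
  have hbound := ((tendsto_ofReal_div_natCast_comp hM (Var[flipSign; bern θ] / δ ^ 2)).add
    (tendsto_ofReal_div_natCast_comp tendsto_id
      (Var[fun x : ℝ => x; gaussianReal 0 1] / δ ^ 2))).add
    (tendsto_ofReal_div_natCast_comp tendsto_id
      (Var[fun x : ℝ => x ^ 2; gaussianReal 0 1] / δ ^ 2))
  rw [add_zero, add_zero] at hbound
  refine tendsto_of_tendsto_of_tendsto_of_le_of_le' tendsto_const_nhds hbound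
    (Eventually.of_forall fun _ => zero_le) ?_
  filter_upwards [eventually_gt_atTop 0, hM.eventually_gt_atTop 0,
    Metric.tendsto_nhds.1 (tendsto_natCast_div_ceil hα) δ hδ] with N hN hMN hr
  generalize Nat.ceil (α * N) = M at hMN hr
  have hfst : ∀ᵐ ω ∂trainMeasure N M θ, ∀ μ, ω.1 μ = 1 ∨ ω.1 μ = 0 :=
    measurePreserving_fst.quasiMeasurePreserving.ae (ae_pi_bern (1 / 2) M)
  have hflips : MeasurePreserving (fun ω : TrainSpace N M => ω.2.1) (trainMeasure N M θ)
      (Measure.pi fun _ => bern θ) := measurePreserving_fst.comp measurePreserving_snd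
  have hnoise := measurePreserving_noiseSum (N := N) hMN (θ := θ)
  have hA := pi_measure_abs_average_sub_le (memLp_flipSign (θ := θ)) hMN hδ
  have hB := pi_measure_abs_average_sub_le hgid hN hδ
  have hD := pi_measure_abs_average_sub_le memLp_sq_gaussianReal hN hδ
  rw [integral_bern hθ0 (by linarith)] at hA
  rw [integral_id_gaussianReal] at hB
  rw [integral_sq_gaussianReal] at hD
  rw [← hflips.measure_preimage (measurableSet_le (by fun_prop) (by
    have := measurable_flipSign; fun_prop)).nullMeasurableSet] at hA
  change stdGaussianVec N _ ≤ _ at hB hD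
  rw [← hnoise.measure_preimage (measurableSet_le (by fun_prop)
    (by fun_prop)).nullMeasurableSet] at hB hD
  refine le_trans ?_ (add_le_add (add_le_add hA hB) hD)
  refine le_trans (measure_mono_ae ?_)
    ((measure_union_le _ _).trans (add_le_add_left (measure_union_le _ _) _))
  filter_upwards [hfst] with ω hω hbad
  by_contra hgood
  have hθs : θ * flipSign 1 + (1 - θ) * flipSign 0 = 1 - 2 * θ := by
    simp only [flipSign]; norm_num; ring
  rw [hθs] at hgood
  obtain ⟨⟨h1, h2⟩, h3⟩ : ((¬ δ ≤ |(∑ μ, flipSign (ω.2.1 μ)) / M - (1 - 2 * θ)|) ∧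
      (¬ δ ≤ |(∑ i, noiseSum ω i) / N - 0|)) ∧
      ¬ δ ≤ |(∑ i, noiseSum ω i ^ 2) / N - 1| := by
    refine ⟨⟨fun h => hgood (Or.inl (Or.inl h)), fun h => hgood (Or.inl (Or.inr h))⟩,
      fun h => hgood (Or.inr h)⟩
  obtain ⟨hq, herr⟩ := hδε (y := trainStats ω) (by
    simp only [Prod.dist_eq, trainStats, max_lt_iff]
    exact ⟨not_le.1 h1, not_le.1 h2, not_le.1 h3, hr⟩)
  rw [← genErr_w0 hN hMN hΔ hω hq] at herr
  exact absurd hbad (not_le.2 herr)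
end
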